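/- Let 1 ≤ n' < n, let p : (Fin n' → Ω) → ℝ with 0 ≤ p ≤ 1 be a (possibly probabilistic) memory-n' strategy of player 2, and let Q : {C,D} × (Fin n → Ω) → ℝ satisfy the player-1 memory-n Bellman optimality equation against p. Then Q does not depend on the oldest recorded state: for every action σ and all histories h, h' : Fin n → Ω with h i = h' i for every i < n − 1, one has Q(σ,h) = Q(σ,h'). -/

import Mathlib

inductive Act where
  | C : Act
  | D : Act
deriving DecidableEq

open Act

abbrev St : Type := Act × Act

/-- Player 1's payoff in the prisoner's dilemma. -/
def r1 (R S T P : ℝ) : Act → Act → ℝ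
  | C, C => R
  | C, D => S
  | D, C => T
  | D, D => P

/-- Prepend the new state `(σ, σ2)` to a memory-`n` history, discarding the oldest state. -/
def push {n : ℕ} (σ σ2 : Act) (h : Fin n → St) : Fin n → St := fun i =>
  if (i : ℕ) = 0 then (σ, σ2)
  else h ⟨(i : ℕ) - 1, Nat.lt_of_le_of_lt (Nat.sub_le _ _) i.isLt⟩

/-- Restrict a memory-`n` history to its `n'` most recent states (`n' ≤ n`). -/
def restrict {n n' : ℕ} (hle : n' ≤ n) (h : Fin n → St) : Fin n' → St := fun i =>
  h ⟨(i : ℕ), Nat.lt_of_lt_of_le i.isLt hle⟩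

/-- a solution of the player-1 memory-`n` Bellman optimality equation against a
memory-`n'` strategy of player 2 (with `n' < n`) does not depend on the oldest recorded state. -/
theorem stmt_13 (R S T P γ : ℝ) (hTR : T > R) (hRP : R > P) (hPS : P > S)
    (h2R : 2 * R > T + S) (hγ0 : 0 ≤ γ) (hγ1 : γ < 1)
    (n' n : ℕ) (hn' : 1 ≤ n') (hnn : n' < n)
    (p : (Fin n' → St) → ℝ) (hp0 : ∀ g, 0 ≤ p g) (hp1 : ∀ g, p g ≤ 1)
    (Q : Act → (Fin n → St) → ℝ)
    (hQ : ∀ σ (h : Fin n → St), Q σ h =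
      p (restrict hnn.le h) *
        (r1 R S T P σ C + γ * max (Q C (push σ C h)) (Q D (push σ C h))) +
      (1 - p (restrict hnn.le h)) *
        (r1 R S T P σ D + γ * max (Q C (push σ D h)) (Q D (push σ D h)))) :
    ∀ (σ : Act) (h h' : Fin n → St),
      (∀ i : Fin n, (i : ℕ) < n - 1 → h i = h' i) → Q σ h = Q σ h' := by
  intro σ h h' hh
  have hpush : ∀ σ2, push σ σ2 h = push σ σ2 h' := by
    intro σ2
    funext i
    unfold push
    split_ifs with hi
    · rfl
    · exact hh _ (by have := i.isLt; simp only; omega)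
  have hrestrict : restrict hnn.le h = restrict hnn.le h' := by
    funext i
    exact hh _ (by have := i.isLt; simp only; omega)
  rw [hQ σ h, hQ σ h', hrestrict, hpush C, hpush D]
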